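/- For every ε ∈ (0,1) there exists a constant C > 0 such that for all integers n ≥ 2, all Δ ∈ (0, 1-ε], and all horizons t ∈ ℕ with 1/Δ² < t ≤ (log n)/Δ², the optimal mutual information satisfies I*_t ≤ C·(tΔ²)²/n. -/

import Mathlib

open scoped BigOperators

noncomputable section

/-- Probability that pulling arm `a` yields reward `r : Bool` (with `true` = reward 1),
when the best arm is `astar`: `Bernoulli ((1+Δ)/2)` if `a = astar`, else `Bernoulli ((1-Δ)/2)`. -/
def rewP (n : ℕ) (Δ : ℝ) (astar a : Fin n) (r : Bool) : ℝ :=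
  if r then (if a = astar then (1 + Δ) / 2 else (1 - Δ) / 2)
  else 1 - (if a = astar then (1 + Δ) / 2 else (1 - Δ) / 2)

/-- An interactive algorithm: for every history (recorded with the most recent pull first),
a probability distribution over the `n` arms used to draw the next pull. -/
def IsAlg (n : ℕ) (alg : List (Fin n × Bool) → Fin n → ℝ) : Prop :=
  ∀ h : List (Fin n × Bool), (∀ a, 0 ≤ alg h a) ∧ (∑ a : Fin n, alg h a) = 1

/-- Probability, conditionally on the best arm `astar`, of observing a given history
(recorded with the most recent pull first) when running the algorithm `alg`. -/
def histP (n : ℕ) (alg : List (Fin n × Bool) → Fin n → ℝ) (Δ : ℝ) (astar : Fin n) :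
    List (Fin n × Bool) → ℝ
  | [] => 1
  | (a, r) :: prev => histP n alg Δ astar prev * alg prev a * rewP n Δ astar a r

/-- The reversed history (most recent pull first) associated with a tuple of `t` pulls. -/
def hist {n t : ℕ} (h : Fin t → Fin n × Bool) : List (Fin n × Bool) :=
  (List.ofFn h).reverse

/-- Success probability `P(a_{t+1} = a*)` of an interactive algorithm after `t` rounds,
under the uniform prior on the best arm. -/
def succProb (n t : ℕ) (alg : List (Fin n × Bool) → Fin n → ℝ) (Δ : ℝ) : ℝ :=
  ((n : ℝ))⁻¹ * ∑ astar : Fin n, ∑ h : Fin t → Fin n × Bool,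
    histP n alg Δ astar (hist h) * alg (hist h) astar

/-- Mutual information (in nats) `I(a*; H_t)` accumulated by an interactive algorithm. -/
def mutualInfo (n t : ℕ) (alg : List (Fin n × Bool) → Fin n → ℝ) (Δ : ℝ) : ℝ :=
  ∑ astar : Fin n, ∑ h : Fin t → Fin n × Bool,
    ((n : ℝ))⁻¹ * histP n alg Δ astar (hist h) *
      Real.log (histP n alg Δ astar (hist h) /
        (((n : ℝ))⁻¹ * ∑ b : Fin n, histP n alg Δ b (hist h)))

/-- Optimal success probability `p*_t`. -/
def pStar (n t : ℕ) (Δ : ℝ) : ℝ :=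
  sSup {x : ℝ | ∃ alg, IsAlg n alg ∧ x = succProb n t alg Δ}

/-- Optimal mutual information `I*_t`. -/
def IStar (n t : ℕ) (Δ : ℝ) : ℝ :=
  sSup {x : ℝ | ∃ alg, IsAlg n alg ∧ x = mutualInfo n t alg Δ}

/-- Reward probabilities of a suboptimal arm. -/
def nullRew (Δ : ℝ) (r : Bool) : ℝ :=
  if r then (1 - Δ) / 2 else (1 + Δ) / 2

/-- Probability of a history when every arm is suboptimal. -/
def nullP (n : ℕ) (alg : List (Fin n × Bool) → Fin n → ℝ) (Δ : ℝ) :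
    List (Fin n × Bool) → ℝ
  | [] => 1
  | (a, r) :: prev => nullP n alg Δ prev * alg prev a * nullRew Δ r

/-- Likelihood ratio of a single reward for the best arm against a suboptimal one. -/
def rewRatio (Δ : ℝ) (r : Bool) : ℝ :=
  if r then (1 + Δ) / (1 - Δ) else (1 - Δ) / (1 + Δ)

/-- Likelihood ratio of a history for best arm `astar` against all arms being suboptimal. -/
def likelihood (n : ℕ) (Δ : ℝ) (astar : Fin n) : List (Fin n × Bool) → ℝ
  | [] => 1
  | (a, r) :: prev => likelihood n Δ astar prev * if a = astar then rewRatio Δ r else 1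

/-- Relative entropy between the reward laws of the best arm and of a suboptimal one. -/
def armKL (Δ : ℝ) : ℝ := Δ * Real.log ((1 + Δ) / (1 - Δ))

/-- The potential `x - 1 - log x`, whose drift along a likelihood ratio is constant. -/
def entropyPotential (x : ℝ) : ℝ := x - 1 - Real.log x

lemma entropyPotential_nonneg {x : ℝ} (hx : 0 < x) : 0 ≤ entropyPotential x := by
  unfold entropyPotential
  linarith [Real.log_le_sub_one_of_pos hx]

lemma le_two_mul_entropyPotential_add {x : ℝ} (hx : 0 < x) :
    x ≤ 2 * entropyPotential x + 2 := by
  have h := Real.log_le_sub_one_of_pos (half_pos hx)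
  rw [Real.log_div hx.ne' two_ne_zero] at h
  have h2 := Real.log_le_sub_one_of_pos (zero_lt_two' ℝ)
  unfold entropyPotential
  linarith

lemma sum_hist_zero {n : ℕ} (F : List (Fin n × Bool) → ℝ) :
    ∑ h : Fin 0 → Fin n × Bool, F (hist h) = F [] := by
  simp [hist]

lemma sum_hist_succ {n t : ℕ} (F : List (Fin n × Bool) → ℝ) :
    ∑ h : Fin (t + 1) → Fin n × Bool, F (hist h) =
      ∑ h : Fin t → Fin n × Bool, ∑ a : Fin n, ∑ r : Bool, F ((a, r) :: hist h) := by
  rw [← (Fin.snocEquiv fun _ : Fin (t + 1) => Fin n × Bool).sum_comp, Fintype.sum_prod_type_right]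
  refine Finset.sum_congr rfl fun h _ => ?_
  rw [Fintype.sum_prod_type]
  refine Finset.sum_congr rfl fun a _ => Finset.sum_congr rfl fun r _ => ?_
  congr 1
  rw [hist, List.ofFn_succ_last]
  simp [hist, Fin.snocEquiv]

lemma rewP_eq {n : ℕ} {Δ : ℝ} (hΔ : Δ ∈ Set.Ioo (0 : ℝ) 1) (astar a : Fin n) (r : Bool) :
    rewP n Δ astar a r = nullRew Δ r * if a = astar then rewRatio Δ r else 1 := by
  have h1 : 1 - Δ ≠ 0 := by linarith [hΔ.2]
  have h2 : 1 + Δ ≠ 0 := by linarith [hΔ.1]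
  by_cases h : a = astar <;> cases r <;> simp [rewP, nullRew, rewRatio, h] <;> field_simp <;> ring

lemma rewRatio_pos {Δ : ℝ} (hΔ : Δ ∈ Set.Ioo (0 : ℝ) 1) (r : Bool) : 0 < rewRatio Δ r := by
  have h1 : 0 < 1 - Δ := by linarith [hΔ.2]
  have h2 : 0 < 1 + Δ := by linarith [hΔ.1]
  cases r <;> simp only [rewRatio] <;> positivity

lemma nullRew_nonneg {Δ : ℝ} (hΔ : Δ ∈ Set.Ioo (0 : ℝ) 1) (r : Bool) : 0 ≤ nullRew Δ r := by
  cases r <;> simp [nullRew] <;> linarith [hΔ.1, hΔ.2]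

lemma sum_nullRew (Δ : ℝ) : ∑ r, nullRew Δ r = 1 := by
  simp [nullRew]; ring

lemma sum_nullRew_mul_rewRatio {Δ : ℝ} (hΔ : Δ ∈ Set.Ioo (0 : ℝ) 1) :
    ∑ r, nullRew Δ r * rewRatio Δ r = 1 := by
  have h1 : 1 - Δ ≠ 0 := by linarith [hΔ.2]
  have h2 : 1 + Δ ≠ 0 := by linarith [hΔ.1]
  simp [nullRew, rewRatio]; field_simp; ring

lemma log_rewRatio {Δ : ℝ} (r : Bool) :
    Real.log (rewRatio Δ r) = (if r then 1 else -1) * Real.log ((1 + Δ) / (1 - Δ)) := by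
  cases r
  · simp [rewRatio, ← Real.log_inv]
  · simp [rewRatio]

lemma sum_nullRew_mul_log_rewRatio (Δ : ℝ) :
    ∑ r, nullRew Δ r * Real.log (rewRatio Δ r) = -armKL Δ := by
  simp [log_rewRatio, nullRew, armKL]; ring

lemma sum_nullRew_mul_rewRatio_mul_log {Δ : ℝ} (hΔ : Δ ∈ Set.Ioo (0 : ℝ) 1) :
    ∑ r, nullRew Δ r * rewRatio Δ r * Real.log (rewRatio Δ r) = armKL Δ := by
  have h1 : 1 - Δ ≠ 0 := by linarith [hΔ.2]
  have h2 : 1 + Δ ≠ 0 := by linarith [hΔ.1]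
  simp only [log_rewRatio]
  simp [nullRew, armKL, rewRatio]; field_simp; ring

lemma armKL_nonneg {Δ : ℝ} (hΔ : Δ ∈ Set.Ioo (0 : ℝ) 1) : 0 ≤ armKL Δ := by
  have h1 : 0 < 1 - Δ := by linarith [hΔ.2]
  refine mul_nonneg hΔ.1.le (Real.log_nonneg ?_)
  rw [le_div_iff₀ h1]
  linarith [hΔ.1]

lemma armKL_le {ε Δ : ℝ} (hε : 0 < ε) (hΔ : Δ ∈ Set.Ioc (0 : ℝ) (1 - ε)) :
    armKL Δ ≤ 2 / ε * Δ ^ 2 := by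
  have hΔ0 := hΔ.1
  have h1 : 0 < 1 - Δ := by linarith [hΔ.2]
  have hlog : Real.log ((1 + Δ) / (1 - Δ)) ≤ 2 * Δ / ε := by
    calc Real.log ((1 + Δ) / (1 - Δ)) ≤ (1 + Δ) / (1 - Δ) - 1 :=
          Real.log_le_sub_one_of_pos (by positivity)
      _ = 2 * Δ / (1 - Δ) := by field_simp; ring
      _ ≤ 2 * Δ / ε := by gcongr; linarith [hΔ.2]
  calc armKL Δ ≤ Δ * (2 * Δ / ε) := by unfold armKL; gcongr
    _ = 2 / ε * Δ ^ 2 := by ring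

lemma likelihood_pos {n : ℕ} {Δ : ℝ} (hΔ : Δ ∈ Set.Ioo (0 : ℝ) 1) (astar : Fin n) :
    ∀ l, 0 < likelihood n Δ astar l
  | [] => one_pos
  | (a, r) :: prev => by
    refine mul_pos (likelihood_pos hΔ astar prev) ?_
    split_ifs
    exacts [rewRatio_pos hΔ r, one_pos]

section Algorithm

variable {n : ℕ} {Δ : ℝ} {alg : List (Fin n × Bool) → Fin n → ℝ}

lemma nullP_nonneg (hΔ : Δ ∈ Set.Ioo (0 : ℝ) 1) (halg : IsAlg n alg) :
    ∀ l, 0 ≤ nullP n alg Δ l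
  | [] => zero_le_one
  | (a, r) :: prev =>
    mul_nonneg (mul_nonneg (nullP_nonneg hΔ halg prev) ((halg prev).1 a)) (nullRew_nonneg hΔ r)

lemma histP_eq (hΔ : Δ ∈ Set.Ioo (0 : ℝ) 1) (astar : Fin n) :
    ∀ l, histP n alg Δ astar l = nullP n alg Δ l * likelihood n Δ astar l
  | [] => by simp [histP, nullP, likelihood]
  | (a, r) :: prev => by
    rw [histP, nullP, likelihood, histP_eq hΔ astar prev, rewP_eq hΔ]
    ring

lemma sum_nullP (halg : IsAlg n alg) (t : ℕ) :
    ∑ h : Fin t → Fin n × Bool, nullP n alg Δ (hist h) = 1 := by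
  induction t with
  | zero => rw [sum_hist_zero (nullP n alg Δ)]; rfl
  | succ t ih =>
    rw [sum_hist_succ (nullP n alg Δ), ← ih]
    refine Finset.sum_congr rfl fun h _ => ?_
    simp_rw [nullP, ← Finset.mul_sum, sum_nullRew, mul_one]
    rw [← Finset.mul_sum, (halg _).2, mul_one]

lemma sum_histP (halg : IsAlg n alg) (astar : Fin n) (t : ℕ) :
    ∑ h : Fin t → Fin n × Bool, histP n alg Δ astar (hist h) = 1 := by
  have hrew : ∀ a, ∑ r, rewP n Δ astar a r = 1 := fun a => by simp [rewP]
  induction t with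
  | zero => rw [sum_hist_zero (histP n alg Δ astar)]; rfl
  | succ t ih =>
    rw [sum_hist_succ (histP n alg Δ astar), ← ih]
    refine Finset.sum_congr rfl fun h _ => ?_
    simp_rw [histP, ← Finset.mul_sum, hrew, mul_one]
    rw [← Finset.mul_sum, (halg _).2, mul_one]

/-- One-step drift of the entropy potential of the likelihood ratio of a fixed arm. -/
lemma potential_step (hΔ : Δ ∈ Set.Ioo (0 : ℝ) 1) (halg : IsAlg n alg) (astar : Fin n)
    (l : List (Fin n × Bool)) :
    ∑ a, ∑ r, nullP n alg Δ ((a, r) :: l) *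
        entropyPotential (likelihood n Δ astar ((a, r) :: l)) =
      nullP n alg Δ l * entropyPotential (likelihood n Δ astar l) +
        nullP n alg Δ l * alg l astar * armKL Δ := by
  have key : ∀ a, ∑ r, nullP n alg Δ ((a, r) :: l) *
      entropyPotential (likelihood n Δ astar ((a, r) :: l)) =
      alg l a * (nullP n alg Δ l * entropyPotential (likelihood n Δ astar l)) +
        if a = astar then nullP n alg Δ l * alg l a * armKL Δ else 0 := by
    intro a
    have hL := likelihood_pos hΔ astar l
    have s1 := sum_nullRew Δ
    have s2 := sum_nullRew_mul_rewRatio hΔ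
    have s3 := sum_nullRew_mul_log_rewRatio Δ
    simp only [Fintype.sum_bool] at s1 s2 s3 ⊢
    by_cases h : a = astar
    · simp only [nullP, likelihood, entropyPotential, h, if_true,
        Real.log_mul hL.ne' (rewRatio_pos hΔ _).ne']
      linear_combination nullP n alg Δ l * alg l astar *
        (likelihood n Δ astar l * s2 - (1 + Real.log (likelihood n Δ astar l)) * s1 - s3)
    · simp only [nullP, likelihood, h, if_false, mul_one]
      linear_combination nullP n alg Δ l * alg l a *
        entropyPotential (likelihood n Δ astar l) * s1
  simp_rw [key, Finset.sum_add_distrib, ← Finset.sum_mul, (halg l).2]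
  simp

lemma sum_potential (hΔ : Δ ∈ Set.Ioo (0 : ℝ) 1) (halg : IsAlg n alg) (t : ℕ) :
    ∑ astar, ∑ h : Fin t → Fin n × Bool,
      nullP n alg Δ (hist h) * entropyPotential (likelihood n Δ astar (hist h)) =
        t * armKL Δ := by
  induction t with
  | zero =>
    refine (Finset.sum_eq_zero fun a _ => ?_).trans (by simp)
    rw [sum_hist_zero fun l => nullP n alg Δ l * entropyPotential (likelihood n Δ a l)]
    simp [likelihood, entropyPotential]
  | succ t ih =>
    have step : ∀ a : Fin n, _ := fun a =>
      sum_hist_succ (t := t) fun l => nullP n alg Δ l * entropyPotential (likelihood n Δ a l)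
    simp_rw [step, potential_step hΔ halg, Finset.sum_add_distrib]
    rw [ih, Finset.sum_comm]
    simp_rw [← Finset.sum_mul, ← Finset.mul_sum, (halg _).2, mul_one, sum_nullP halg]
    push_cast
    ring

/-- The (unnormalised) success probability grows at most linearly in the horizon. -/
lemma sum_histP_mul_alg_le (hΔ : Δ ∈ Set.Ioo (0 : ℝ) 1) (halg : IsAlg n alg) (t : ℕ) :
    ∑ astar, ∑ h : Fin t → Fin n × Bool, histP n alg Δ astar (hist h) * alg (hist h) astar ≤
      2 * (t * armKL Δ) + 2 := by
  have hterm : ∀ (a : Fin n) (l : List (Fin n × Bool)),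
      histP n alg Δ a l * alg l a ≤
        2 * (nullP n alg Δ l * entropyPotential (likelihood n Δ a l)) +
          2 * (nullP n alg Δ l * alg l a) := by
    intro a l
    have hL := likelihood_pos hΔ a l
    have h0 := (halg l).1 a
    have h1 : alg l a ≤ 1 := (halg l).2 ▸
      Finset.single_le_sum (fun b _ => (halg l).1 b) (Finset.mem_univ a)
    have hf := entropyPotential_nonneg hL
    have hL2 := le_two_mul_entropyPotential_add hL
    rw [histP_eq hΔ, mul_assoc]
    calc nullP n alg Δ l * (likelihood n Δ a l * alg l a)
        ≤ nullP n alg Δ l * (2 * entropyPotential (likelihood n Δ a l) + 2 * alg l a) := by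
          refine mul_le_mul_of_nonneg_left ?_ (nullP_nonneg hΔ halg l)
          nlinarith [mul_le_mul_of_nonneg_right hL2 h0, mul_le_of_le_one_right hf h1]
      _ = _ := by ring
  calc _ ≤ ∑ a, ∑ h : Fin t → Fin n × Bool,
        (2 * (nullP n alg Δ (hist h) * entropyPotential (likelihood n Δ a (hist h))) +
          2 * (nullP n alg Δ (hist h) * alg (hist h) a)) :=
        Finset.sum_le_sum fun a _ => Finset.sum_le_sum fun h _ => hterm a _
    _ = 2 * (t * armKL Δ) + 2 := by
      simp_rw [Finset.sum_add_distrib, ← Finset.mul_sum]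
      rw [sum_potential hΔ halg, Finset.sum_comm]
      simp_rw [← Finset.mul_sum, (halg _).2, mul_one, sum_nullP halg]
      ring

/-- Chain rule: the expected log-likelihood ratio grows by `armKL Δ` per pull of the best arm. -/
lemma logLikelihood_step (hΔ : Δ ∈ Set.Ioo (0 : ℝ) 1) (halg : IsAlg n alg) (astar : Fin n)
    (l : List (Fin n × Bool)) :
    ∑ a, ∑ r, histP n alg Δ astar ((a, r) :: l) *
        Real.log (likelihood n Δ astar ((a, r) :: l)) =
      histP n alg Δ astar l * Real.log (likelihood n Δ astar l) +
        histP n alg Δ astar l * alg l astar * armKL Δ := by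
  have key : ∀ a, ∑ r, histP n alg Δ astar ((a, r) :: l) *
      Real.log (likelihood n Δ astar ((a, r) :: l)) =
      alg l a * (histP n alg Δ astar l * Real.log (likelihood n Δ astar l)) +
        if a = astar then histP n alg Δ astar l * alg l a * armKL Δ else 0 := by
    intro a
    have hL := likelihood_pos hΔ astar l
    have s1 := sum_nullRew Δ
    have s2 := sum_nullRew_mul_rewRatio hΔ
    have s3 := sum_nullRew_mul_rewRatio_mul_log hΔ
    simp only [Fintype.sum_bool] at s1 s2 s3 ⊢
    by_cases h : a = astar
    · simp only [histP, rewP_eq hΔ, likelihood, h, if_true,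
        Real.log_mul hL.ne' (rewRatio_pos hΔ _).ne']
      linear_combination histP n alg Δ astar l * alg l astar *
        (Real.log (likelihood n Δ astar l) * s2 + s3)
    · simp only [histP, rewP_eq hΔ, likelihood, h, if_false, mul_one]
      linear_combination histP n alg Δ astar l * alg l a *
        Real.log (likelihood n Δ astar l) * s1
  simp_rw [key, Finset.sum_add_distrib, ← Finset.sum_mul, (halg l).2]
  simp

lemma sum_logLikelihood_le (hΔ : Δ ∈ Set.Ioo (0 : ℝ) 1) (halg : IsAlg n alg) (t : ℕ) :
    ∑ astar, ∑ h : Fin t → Fin n × Bool,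
      histP n alg Δ astar (hist h) * Real.log (likelihood n Δ astar (hist h)) ≤
        2 * (t * armKL Δ) + (t * armKL Δ) ^ 2 := by
  have hK := armKL_nonneg hΔ
  induction t with
  | zero =>
    refine (Finset.sum_eq_zero fun a _ => ?_).trans_le (by simp)
    rw [sum_hist_zero fun l => histP n alg Δ a l * Real.log (likelihood n Δ a l)]
    simp [likelihood]
  | succ t ih =>
    have step : ∀ a : Fin n, _ := fun a =>
      sum_hist_succ (t := t) fun l => histP n alg Δ a l * Real.log (likelihood n Δ a l)
    simp_rw [step, logLikelihood_step hΔ halg, Finset.sum_add_distrib, ← Finset.sum_mul]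
    have h := mul_le_mul_of_nonneg_right (sum_histP_mul_alg_le hΔ halg t) hK
    push_cast
    nlinarith [sq_nonneg (armKL Δ)]

lemma mutualInfo_le_sum_logLikelihood (hn : n ≠ 0) (hΔ : Δ ∈ Set.Ioo (0 : ℝ) 1)
    (halg : IsAlg n alg) (t : ℕ) :
    mutualInfo n t alg Δ ≤ (n : ℝ)⁻¹ * ∑ astar, ∑ h : Fin t → Fin n × Bool,
      histP n alg Δ astar (hist h) * Real.log (likelihood n Δ astar (hist h)) := by
  have hn0 : (0 : ℝ) < n := by exact_mod_cast Nat.pos_of_ne_zero hn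
  have : Nonempty (Fin n) := ⟨⟨0, Nat.pos_of_ne_zero hn⟩⟩
  have hpt : ∀ l : List (Fin n × Bool),
      ∑ a, (n : ℝ)⁻¹ * histP n alg Δ a l *
        Real.log (histP n alg Δ a l / ((n : ℝ)⁻¹ * ∑ b, histP n alg Δ b l)) ≤
      (n : ℝ)⁻¹ * ∑ a, histP n alg Δ a l * Real.log (likelihood n Δ a l) +
        (nullP n alg Δ l - (n : ℝ)⁻¹ * ∑ a, histP n alg Δ a l) := by
    intro l
    have hP := nullP_nonneg hΔ halg l
    have hLpos := fun a => likelihood_pos (n := n) hΔ a l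
    set P := nullP n alg Δ l
    set m := (n : ℝ)⁻¹ * ∑ a, likelihood n Δ a l with hm_def
    have hm : 0 < m := mul_pos (inv_pos.2 hn0)
      (Finset.sum_pos (fun a _ => hLpos a) Finset.univ_nonempty)
    have hmean : (n : ℝ)⁻¹ * ∑ a, histP n alg Δ a l = P * m := by
      simp_rw [histP_eq hΔ, ← Finset.mul_sum]
      rw [hm_def]; ring
    have hlog : ∀ a, (n : ℝ)⁻¹ * histP n alg Δ a l * Real.log (histP n alg Δ a l / (P * m)) =
        (n : ℝ)⁻¹ * (histP n alg Δ a l * Real.log (likelihood n Δ a l)) -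
          (n : ℝ)⁻¹ * histP n alg Δ a l * Real.log m := by
      intro a
      rw [show histP n alg Δ a l = P * likelihood n Δ a l from histP_eq hΔ a l]
      rcases hP.eq_or_lt with h0 | h0
      · simp [← h0]
      · rw [mul_div_mul_left _ _ h0.ne', Real.log_div (hLpos a).ne' hm.ne']
        ring
    rw [hmean]
    simp_rw [hlog, Finset.sum_sub_distrib, ← Finset.sum_mul, ← Finset.mul_sum]
    rw [hmean]
    have hinv := Real.one_sub_inv_le_log_of_pos hm
    have : m - 1 ≤ m * Real.log m := by
      calc m - 1 = m * (1 - m⁻¹) := by field_simp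
        _ ≤ _ := by gcongr
    nlinarith [mul_le_mul_of_nonneg_left this hP]
  unfold mutualInfo
  rw [Finset.sum_comm]
  refine (Finset.sum_le_sum fun h _ => hpt (hist h)).trans_eq ?_
  rw [Finset.sum_add_distrib, Finset.sum_sub_distrib, sum_nullP halg, ← Finset.mul_sum,
    ← Finset.mul_sum, Finset.sum_comm,
    Finset.sum_comm (f := fun (h : Fin t → Fin n × Bool) a => histP n alg Δ a (hist h))]
  simp_rw [sum_histP halg]
  simp [hn0.ne']

end Algorithm

/-- Converse for the mutual information at intermediate `t`: for every `ε ∈ (0,1)` there is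
`C > 0` such that for all `n ≥ 2`, `Δ ∈ (0, 1-ε]` and horizons `1/Δ² < t ≤ (log n)/Δ²`,
`I*_t ≤ C (tΔ²)² / n`. -/
theorem bandit_info_converse_intermediate_t :
    ∀ ε : ℝ, ε ∈ Set.Ioo (0 : ℝ) 1 → ∃ C : ℝ, 0 < C ∧
      ∀ n : ℕ, 2 ≤ n → ∀ Δ : ℝ, Δ ∈ Set.Ioc (0 : ℝ) (1 - ε) →
        ∀ t : ℕ, 1 / Δ ^ 2 < (t : ℝ) → (t : ℝ) ≤ Real.log n / Δ ^ 2 →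
          IStar n t Δ ≤ C * ((t : ℝ) * Δ ^ 2) ^ 2 / n := by
  rintro ε ⟨hε, -⟩
  have hK : 0 < 2 / ε := by positivity
  refine ⟨2 * (2 / ε) + (2 / ε) ^ 2, by positivity, ?_⟩
  intro n hn Δ hΔ t ht _
  have hΔ0 := hΔ.1
  have hΔ' : Δ ∈ Set.Ioo (0 : ℝ) 1 := ⟨hΔ0, by linarith [hΔ.2]⟩
  have hx : 1 ≤ (t : ℝ) * Δ ^ 2 := ((div_lt_iff₀ (by positivity)).1 ht).le
  refine Real.sSup_le ?_ (by positivity)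
  rintro _ ⟨alg, halg, rfl⟩
  have hkl0 := armKL_nonneg hΔ'
  have hkl : t * armKL Δ ≤ 2 / ε * (t * Δ ^ 2) := by
    calc t * armKL Δ ≤ t * (2 / ε * Δ ^ 2) := by gcongr; exact armKL_le hε hΔ
      _ = _ := by ring
  calc mutualInfo n t alg Δ
      ≤ (n : ℝ)⁻¹ * (2 * (t * armKL Δ) + (t * armKL Δ) ^ 2) :=
        (mutualInfo_le_sum_logLikelihood (by omega) hΔ' halg t).trans <|
          mul_le_mul_of_nonneg_left (sum_logLikelihood_le hΔ' halg t) (by positivity)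
    _ ≤ (n : ℝ)⁻¹ * (2 * (2 / ε * (t * Δ ^ 2)) + (2 / ε * (t * Δ ^ 2)) ^ 2) := by gcongr
    _ ≤ (n : ℝ)⁻¹ * ((2 * (2 / ε) + (2 / ε) ^ 2) * (t * Δ ^ 2) ^ 2) := by
        gcongr
        nlinarith [mul_le_mul_of_nonneg_left (mul_le_mul_of_nonneg_left hx (zero_le_one.trans hx))
          hK.le]
    _ = _ := by ring
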